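/- Let d ≥ 1, ν ≥ 0, 0 ≤ t₀ < t₁. Let v_t : ℤ^d → ℂ^d be divergence-free and real for every t ∈ [t₀,t₁], with t ↦ Σ_k (1+|k|)|v_t(k)| integrable on [t₀,t₁], and let a_t : ℤ^d → ℂ solve the Fourier advection–diffusion system with diffusivity ν and velocity v on [t₀,t₁], with a rapidly decreasing locally uniformly in time. Then the energy identity holds: Σ_k |a_{t₁}(k)|² + 8π²ν ∫_{t₀}^{t₁} Σ_k |k|² |a_t(k)|² dt = Σ_k |a_{t₀}(k)|². -/

import Mathlib

open MeasureTheory ENNReal Real Set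
open scoped Classical

noncomputable section

/-- Euclidean norm of a lattice point `k ∈ ℤ^d`. -/
def znorm {d : ℕ} (k : Fin d → ℤ) : ℝ := Real.sqrt (∑ i, ((k i : ℝ)) ^ 2)

/-- Euclidean norm of a vector in `ℂ^d`. -/
def cnorm {d : ℕ} (z : Fin d → ℂ) : ℝ := Real.sqrt (∑ i, ‖z i‖ ^ 2)

/-- Pairing `k · z = Σ_i k_i z_i`. -/
def zdot {d : ℕ} (k : Fin d → ℤ) (z : Fin d → ℂ) : ℂ := ∑ i, (k i : ℂ) * z i

/-- Divergence-free in Fourier variables: `k · v(k) = 0` for all `k`. -/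
def DivFree {d : ℕ} (v : (Fin d → ℤ) → Fin d → ℂ) : Prop := ∀ k, zdot k (v k) = 0

/-- Fourier coefficients of a real vector field: `v(-k) = conj (v k)`. -/
def RealCoeff {d : ℕ} (v : (Fin d → ℤ) → Fin d → ℂ) : Prop :=
  ∀ k i, v (-k) i = starRingEnd ℂ (v k i)

/-- A weight: nondecreasing on `[0,∞)` with values in `[1,∞]`. -/
def IsWeight (w : ℝ → ℝ≥0∞) : Prop :=
  MonotoneOn w (Set.Ici 0) ∧ ∀ s, 0 ≤ s → 1 ≤ w s

/-- Weighted ℓ¹ norm `‖w v‖_{ℓ¹} = Σ_k w(|k|)|v(k)|`. -/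
def wl1 {d : ℕ} (w : ℝ → ℝ≥0∞) (v : (Fin d → ℤ) → Fin d → ℂ) : ℝ≥0∞ :=
  ∑' k, w (znorm k) * ENNReal.ofReal (cnorm (v k))

/-- `(w⁻¹ * m_a)(r) = Σ_k w(||k|-r|)⁻¹ |a(k)|²`. -/
def convMass {d : ℕ} (w : ℝ → ℝ≥0∞) (a : (Fin d → ℤ) → ℂ) (r : ℝ) : ℝ≥0∞ :=
  ∑' k, (w |znorm k - r|)⁻¹ * (‖a k‖₊ : ℝ≥0∞) ^ 2

/-- `m_a(E) = Σ_{|k| ∈ E} |a(k)|²`. -/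
def massOn {d : ℕ} (a : (Fin d → ℤ) → ℂ) (E : Set ℝ) : ℝ≥0∞ :=
  ∑' k, if znorm k ∈ E then (‖a k‖₊ : ℝ≥0∞) ^ 2 else 0

/-- Logarithmic density measure `μ_{a,b}(E)`. -/
def logDensity (a b : ℝ) (E : Set ℝ) : ℝ≥0∞ :=
  (ENNReal.ofReal (Real.log (b / a)))⁻¹ * ∫⁻ r in E ∩ Set.Icc a b, ENNReal.ofReal r⁻¹

/-- The right-hand side of the Fourier advection–diffusion system. -/
def fourierRHS {d : ℕ} (ν : ℝ) (v : (Fin d → ℤ) → Fin d → ℂ) (a : (Fin d → ℤ) → ℂ)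
    (k : Fin d → ℤ) : ℂ :=
  Complex.ofReal (-(4 * π ^ 2 * ν * znorm k ^ 2)) * a k
    - 2 * Complex.ofReal π * Complex.I * ∑' j, zdot k (v (k - j)) * a j


/-- The advection term `Σ_j (k · v(k-j)) a(j)`. -/
def advection {d : ℕ} (v : (Fin d → ℤ) → Fin d → ℂ) (a : (Fin d → ℤ) → ℂ)
    (k : Fin d → ℤ) : ℂ :=
  ∑' j, zdot k (v (k - j)) * a j

/-- The rate of transfer of energy into mode `k` by advection. -/
def energyTransfer {d : ℕ} (v : (Fin d → ℤ) → Fin d → ℂ) (a : (Fin d → ℤ) → ℂ)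
    (k : Fin d → ℤ) : ℝ :=
  4 * π * (starRingEnd ℂ (a k) * advection v a k).im

/-- The weighted energy `Σ_k (1+|k|)² |a(k)|²`. -/
def sobolevMass {d : ℕ} (a : (Fin d → ℤ) → ℂ) : ℝ≥0∞ :=
  ∑' k, ENNReal.ofReal ((1 + znorm k) ^ 2) * (‖a k‖₊ : ℝ≥0∞) ^ 2

lemma znorm_nonneg {d : ℕ} (k : Fin d → ℤ) : 0 ≤ znorm k := Real.sqrt_nonneg _

lemma cnorm_nonneg {d : ℕ} (z : Fin d → ℂ) : 0 ≤ cnorm z := Real.sqrt_nonneg _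

lemma norm_zdot_le {d : ℕ} (k : Fin d → ℤ) (z : Fin d → ℂ) :
    ‖zdot k z‖ ≤ znorm k * cnorm z := by
  calc ‖zdot k z‖ ≤ ∑ i, |(k i : ℝ)| * ‖z i‖ := by
        refine (norm_sum_le _ _).trans_eq (Finset.sum_congr rfl fun i _ => ?_)
        rw [norm_mul, Complex.norm_intCast]
    _ ≤ √(∑ i, |(k i : ℝ)| ^ 2) * √(∑ i, ‖z i‖ ^ 2) :=
        Real.sum_mul_le_sqrt_mul_sqrt _ _ _
    _ = znorm k * cnorm z := by simp [znorm, cnorm]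

lemma ofReal_sq_mul_nnnorm_sq {d : ℕ} (a : (Fin d → ℤ) → ℂ) (k : Fin d → ℤ) :
    ENNReal.ofReal ((1 + znorm k) ^ 2) * (‖a k‖₊ : ℝ≥0∞) ^ 2
      = ENNReal.ofReal ((1 + znorm k) ^ 2 * ‖a k‖ ^ 2) := by
  rw [ENNReal.ofReal_mul (by positivity), ENNReal.ofReal_pow (norm_nonneg _), ofReal_norm,
    enorm_eq_nnnorm]

lemma enorm_interaction_le {d : ℕ} (v : (Fin d → ℤ) → Fin d → ℂ) (a : (Fin d → ℤ) → ℂ)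
    (k j : Fin d → ℤ) :
    ‖starRingEnd ℂ (a k) * (zdot k (v (k - j)) * a j)‖ₑ
      ≤ ENNReal.ofReal (cnorm (v (k - j))) *
          (ENNReal.ofReal ((1 + znorm k) ^ 2) * (‖a k‖₊ : ℝ≥0∞) ^ 2
            + ENNReal.ofReal ((1 + znorm j) ^ 2) * (‖a j‖₊ : ℝ≥0∞) ^ 2) := by
  have hk := znorm_nonneg k
  have hj := znorm_nonneg j
  have hc := cnorm_nonneg (v (k - j))
  rw [ofReal_sq_mul_nnnorm_sq, ofReal_sq_mul_nnnorm_sq,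
    ← ENNReal.ofReal_add (by positivity) (by positivity), ← ENNReal.ofReal_mul hc,
    ← ofReal_norm]
  refine ENNReal.ofReal_le_ofReal ?_
  rw [norm_mul, norm_mul, RCLike.norm_conj]
  calc ‖a k‖ * (‖zdot k (v (k - j))‖ * ‖a j‖)
      ≤ ‖a k‖ * ((znorm k * cnorm (v (k - j))) * ‖a j‖) := by
        gcongr; exact norm_zdot_le _ _
    _ = cnorm (v (k - j)) * ((znorm k * ‖a k‖) * ‖a j‖) := by ring
    _ ≤ cnorm (v (k - j)) * (((1 + znorm k) * ‖a k‖) * ((1 + znorm j) * ‖a j‖)) := by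
        gcongr
        · linarith
        · exact le_mul_of_one_le_left (norm_nonneg _) (by linarith)
    _ ≤ _ := by
        gcongr
        nlinarith [sq_nonneg ((1 + znorm k) * ‖a k‖ - (1 + znorm j) * ‖a j‖),
          sq_nonneg ((1 + znorm k) * ‖a k‖), sq_nonneg ((1 + znorm j) * ‖a j‖)]

lemma tsum_enorm_interaction_le {d : ℕ} (v : (Fin d → ℤ) → Fin d → ℂ)
    (a : (Fin d → ℤ) → ℂ) :
    ∑' k, ∑' j, ‖starRingEnd ℂ (a k) * (zdot k (v (k - j)) * a j)‖ₑ
      ≤ 2 * sobolevMass a * ∑' k, ENNReal.ofReal ((1 + znorm k) * cnorm (v k)) := by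
  set c : (Fin d → ℤ) → ℝ≥0∞ := fun k => ENNReal.ofReal (cnorm (v k)) with hc
  set A : (Fin d → ℤ) → ℝ≥0∞ :=
    fun k => ENNReal.ofReal ((1 + znorm k) ^ 2) * (‖a k‖₊ : ℝ≥0∞) ^ 2 with hA
  have hl : ∑' k, ∑' j, c (k - j) * A k = (∑' k, c k) * ∑' k, A k := by
    rw [← ENNReal.tsum_mul_left]
    refine tsum_congr fun k => ?_
    rw [ENNReal.tsum_mul_right]
    congr 1
    exact (Equiv.subLeft k).tsum_eq c
  have hr : ∑' k, ∑' j, c (k - j) * A j = (∑' k, c k) * ∑' k, A k := by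
    rw [ENNReal.tsum_comm, ← ENNReal.tsum_mul_left]
    refine tsum_congr fun j => ?_
    rw [ENNReal.tsum_mul_right]
    congr 1
    exact (Equiv.subRight j).tsum_eq c
  calc _ ≤ ∑' k, ∑' j, c (k - j) * (A k + A j) :=
        ENNReal.tsum_le_tsum fun k => ENNReal.tsum_le_tsum fun j => enorm_interaction_le v a k j
    _ = 2 * (∑' k, A k) * ∑' k, c k := by
        simp_rw [mul_add, ENNReal.tsum_add]
        rw [hl, hr]
        ring
    _ ≤ _ := by
        refine mul_le_mul_right (ENNReal.tsum_le_tsum fun k => ENNReal.ofReal_le_ofReal ?_) _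
        nlinarith [mul_nonneg (znorm_nonneg k) (cnorm_nonneg (v k))]

lemma enorm_energyTransfer_le {d : ℕ} (v : (Fin d → ℤ) → Fin d → ℂ) (a : (Fin d → ℤ) → ℂ)
    (k : Fin d → ℤ) :
    ‖energyTransfer v a k‖ₑ ≤ ENNReal.ofReal (4 * π) *
      ∑' j, ‖starRingEnd ℂ (a k) * (zdot k (v (k - j)) * a j)‖ₑ := by
  rw [energyTransfer, enorm_mul, Real.enorm_eq_ofReal (by positivity), advection,
    ← tsum_mul_left]
  gcongr
  refine le_trans ?_ enorm_tsum_le_tsum_enorm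
  rw [← ofReal_norm, ← ofReal_norm]
  exact ENNReal.ofReal_le_ofReal (Complex.abs_im_le_norm _)

lemma tsum_enorm_energyTransfer_le {d : ℕ} (v : (Fin d → ℤ) → Fin d → ℂ)
    (a : (Fin d → ℤ) → ℂ) :
    ∑' k, ‖energyTransfer v a k‖ₑ ≤ ENNReal.ofReal (4 * π) *
      (2 * sobolevMass a * ∑' k, ENNReal.ofReal ((1 + znorm k) * cnorm (v k))) := by
  refine (ENNReal.tsum_le_tsum (enorm_energyTransfer_le v a)).trans ?_
  rw [ENNReal.tsum_mul_left]
  gcongr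
  exact tsum_enorm_interaction_le v a

lemma zdot_eq_of_divFree {d : ℕ} {v : (Fin d → ℤ) → Fin d → ℂ} (hdiv : DivFree v)
    (k j : Fin d → ℤ) : zdot k (v (k - j)) = zdot j (v (k - j)) := by
  have h := hdiv (k - j)
  simp only [zdot, Pi.sub_apply, Int.cast_sub, sub_mul, Finset.sum_sub_distrib] at h ⊢
  exact sub_eq_zero.mp h

lemma conj_zdot {d : ℕ} {v : (Fin d → ℤ) → Fin d → ℂ} (hreal : RealCoeff v)
    (k l : Fin d → ℤ) : starRingEnd ℂ (zdot k (v l)) = zdot k (v (-l)) := by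
  simp [zdot, hreal l]

/-- Advection by a real divergence-free field transfers energy between modes without
creating any. -/
lemma tsum_energyTransfer_eq_zero {d : ℕ} {v : (Fin d → ℤ) → Fin d → ℂ}
    (hdiv : DivFree v) (hreal : RealCoeff v) {a : (Fin d → ℤ) → ℂ}
    (hv : ∑' k, ENNReal.ofReal ((1 + znorm k) * cnorm (v k)) ≠ ⊤) (ha : sobolevMass a ≠ ⊤) :
    ∑' k, energyTransfer v a k = 0 := by
  set B : (Fin d → ℤ) → (Fin d → ℤ) → ℂ :=
    fun k j => starRingEnd ℂ (a k) * (zdot k (v (k - j)) * a j) with hB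
  have hsum : Summable (Function.uncurry B) := by
    refine Summable.of_enorm ?_
    rw [ENNReal.tsum_prod']
    exact ne_top_of_le_ne_top (by finiteness) (tsum_enorm_interaction_le v a)
  have hconj (k j) : starRingEnd ℂ (B k j) = B j k := by
    simp only [hB, map_mul, Complex.conj_conj, conj_zdot hreal, neg_sub]
    rw [← zdot_eq_of_divFree hdiv j k]
    ring
  have hsum' : Summable fun k => ∑' j, B k j := hsum.prod
  have him : (∑' k, ∑' j, B k j).im = 0 := by
    rw [← Complex.conj_eq_iff_im, Complex.conj_tsum]
    simp_rw [Complex.conj_tsum, hconj]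
    exact hsum.tsum_comm
  simp_rw [energyTransfer, advection, ← tsum_mul_left]
  rw [tsum_mul_left, ← Complex.im_tsum hsum', him, mul_zero]

lemma two_mul_inner_fourierRHS {d : ℕ} (ν : ℝ) (v : (Fin d → ℤ) → Fin d → ℂ)
    (a : (Fin d → ℤ) → ℂ) (k : Fin d → ℤ) :
    2 * inner ℝ (a k) (fourierRHS ν v a k)
      = energyTransfer v a k - 8 * π ^ 2 * ν * (znorm k ^ 2 * ‖a k‖ ^ 2) := by
  rw [Complex.inner, fourierRHS, energyTransfer, ← advection, ← Complex.normSq_eq_norm_sq,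
    Complex.normSq_apply]
  simp only [Complex.mul_re, Complex.mul_im, Complex.sub_re, Complex.sub_im, Complex.conj_re,
    Complex.conj_im, Complex.ofReal_re, Complex.ofReal_im, Complex.I_re, Complex.I_im,
    Complex.re_ofNat, Complex.im_ofNat]
  ring

/-- Fubini for series of functions, with convergence of the series of integrals. -/
lemma hasSum_integral_of_lintegral_tsum_enorm {α ι : Type*} [MeasurableSpace α] [Countable ι]
    {μ : Measure α} {f : ι → α → ℝ} (hf : ∀ i, AEStronglyMeasurable (f i) μ)
    (hfin : ∫⁻ t, ∑' i, ‖f i t‖ₑ ∂μ ≠ ⊤) :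
    HasSum (fun i => ∫ t, f i t ∂μ) (∫ t, ∑' i, f i t ∂μ) := by
  rw [lintegral_tsum fun i => (hf i).enorm] at hfin
  rw [integral_tsum hf hfin]
  refine (Summable.of_enorm (ne_top_of_le_ne_top hfin ?_)).hasSum
  exact ENNReal.tsum_le_tsum fun i => enorm_integral_le_lintegral_enorm _

lemma summable_norm_sq_of_sobolevMass {d : ℕ} {a : (Fin d → ℤ) → ℂ} (ha : sobolevMass a ≠ ⊤) :
    Summable fun k => ‖a k‖ ^ 2 := by
  refine Summable.of_enorm (ne_top_of_le_ne_top ha (ENNReal.tsum_le_tsum fun k => ?_))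
  rw [ofReal_sq_mul_nnnorm_sq, Real.enorm_eq_ofReal (by positivity)]
  refine ENNReal.ofReal_le_ofReal (le_mul_of_one_le_left (by positivity) ?_)
  exact one_le_pow₀ (by linarith [znorm_nonneg k])

lemma tsum_enorm_dissipation_le {d : ℕ} (a : (Fin d → ℤ) → ℂ) :
    ∑' k, ‖znorm k ^ 2 * ‖a k‖ ^ 2‖ₑ ≤ sobolevMass a := by
  refine ENNReal.tsum_le_tsum fun k => ?_
  rw [ofReal_sq_mul_nnnorm_sq, Real.enorm_eq_ofReal (by positivity)]
  refine ENNReal.ofReal_le_ofReal ?_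
  have := znorm_nonneg k
  gcongr
  linarith

/-- The energy balance of a single Fourier mode. -/
lemma mode_energy_balance {d : ℕ} {ν t₀ t₁ : ℝ} (ht : t₀ ≤ t₁)
    {v : ℝ → (Fin d → ℤ) → Fin d → ℂ} {a : ℝ → (Fin d → ℤ) → ℂ} {k : Fin d → ℤ}
    (hODE : ∀ t ∈ Icc t₀ t₁,
      HasDerivWithinAt (fun s => a s k) (fourierRHS ν (v t) (a t) k) (Icc t₀ t₁) t)
    (htransfer : ContinuousOn (fun t => energyTransfer (v t) (a t) k) (Icc t₀ t₁)) :
    ‖a t₁ k‖ ^ 2 + 8 * π ^ 2 * ν * ∫ t in t₀..t₁, znorm k ^ 2 * ‖a t k‖ ^ 2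
      = ‖a t₀ k‖ ^ 2 + ∫ t in t₀..t₁, energyTransfer (v t) (a t) k := by
  have ha : ContinuousOn (fun t => a t k) (Icc t₀ t₁) := fun t h => (hODE t h).continuousWithinAt
  have hdiss : ContinuousOn (fun t => znorm k ^ 2 * ‖a t k‖ ^ 2) (Icc t₀ t₁) := by fun_prop
  have hi₁ := htransfer.intervalIntegrable_of_Icc (μ := volume) ht
  have hi₂ := (hdiss.intervalIntegrable_of_Icc (μ := volume) ht).const_mul (8 * π ^ 2 * ν)
  have hFTC := intervalIntegral.integral_eq_sub_of_hasDerivAt_of_le ht (ha.norm.pow 2)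
    (f' := fun t => energyTransfer (v t) (a t) k
      - 8 * π ^ 2 * ν * (znorm k ^ 2 * ‖a t k‖ ^ 2))
    (fun t h => by
      rw [← two_mul_inner_fourierRHS]
      exact ((hODE t (Ioo_subset_Icc_self h)).hasDerivAt (Icc_mem_nhds h.1 h.2)).norm_sq)
    (hi₁.sub hi₂)
  rw [intervalIntegral.integral_sub hi₁ hi₂, intervalIntegral.integral_const_mul] at hFTC
  simp only [Pi.pow_apply] at hFTC
  linarith

lemma continuousOn_energyTransfer {d : ℕ} {ν : ℝ} {s : Set ℝ}
    {v : ℝ → (Fin d → ℤ) → Fin d → ℂ} {a : ℝ → (Fin d → ℤ) → ℂ} {k : Fin d → ℤ}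
    (ha : ContinuousOn (fun t => a t k) s)
    (hrhs : ContinuousOn (fun t => fourierRHS ν (v t) (a t) k) s) :
    ContinuousOn (fun t => energyTransfer (v t) (a t) k) s := by
  have h (t : ℝ) : energyTransfer (v t) (a t) k = 2 * inner ℝ (a t k) (fourierRHS ν (v t) (a t) k)
      + 8 * π ^ 2 * ν * (znorm k ^ 2 * ‖a t k‖ ^ 2) := by
    rw [two_mul_inner_fourierRHS]; ring
  simp_rw [h]
  fun_prop

/-- the energy identity for the Fourier advection–diffusion system. -/
theorem energy_identity {d : ℕ} (hd : 1 ≤ d) (ν t₀ t₁ : ℝ)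
    (hν : 0 ≤ ν) (ht₀ : 0 ≤ t₀) (ht : t₀ < t₁)
    (v : ℝ → (Fin d → ℤ) → Fin d → ℂ)
    (hdiv : ∀ t ∈ Set.Icc t₀ t₁, DivFree (v t))
    (hreal : ∀ t ∈ Set.Icc t₀ t₁, RealCoeff (v t))
    (hvmeas : Measurable fun t => ∑' k : Fin d → ℤ, ENNReal.ofReal ((1 + znorm k) * cnorm (v t k)))
    (hvint : ∫⁻ t in Set.Icc t₀ t₁,
        (∑' k : Fin d → ℤ, ENNReal.ofReal ((1 + znorm k) * cnorm (v t k))) ≠ ⊤)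
    (a : ℝ → (Fin d → ℤ) → ℂ)
    (hODE : ∀ (k : Fin d → ℤ), ∀ t ∈ Set.Icc t₀ t₁,
      HasDerivWithinAt (fun s => a s k) (fourierRHS ν (v t) (a t) k) (Set.Icc t₀ t₁) t)
    (hC1 : ∀ k : Fin d → ℤ, ContinuousOn (fun t => fourierRHS ν (v t) (a t) k) (Set.Icc t₀ t₁))
    (hrapid : ∀ N : ℕ, ∀ T > (0 : ℝ), ∃ M : ℝ, ∀ t ∈ Set.Icc t₀ T,
      ∑' k : Fin d → ℤ, ENNReal.ofReal ((1 + znorm k) ^ N) * (‖a t k‖₊ : ℝ≥0∞) ^ 2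
        ≤ ENNReal.ofReal M) :
    (∑' k : Fin d → ℤ, ‖a t₁ k‖ ^ 2)
      + 8 * π ^ 2 * ν * ∫ t in t₀..t₁, ∑' k : Fin d → ℤ, znorm k ^ 2 * ‖a t k‖ ^ 2
      = ∑' k : Fin d → ℤ, ‖a t₀ k‖ ^ 2 := by
  obtain ⟨M, hM⟩ := hrapid 2 t₁ (ht₀.trans_lt ht)
  have hmass : ∀ t ∈ Icc t₀ t₁, sobolevMass (a t) ≤ ENNReal.ofReal M := hM
  have hmass' : ∀ t ∈ Icc t₀ t₁, sobolevMass (a t) ≠ ⊤ := fun t h =>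
    ne_top_of_le_ne_top ENNReal.ofReal_ne_top (hmass t h)
  have ha (k) : ContinuousOn (fun t => a t k) (Icc t₀ t₁) :=
    fun t h => (hODE k t h).continuousWithinAt
  have htransfer (k) := continuousOn_energyTransfer (ha k) (hC1 k)
  have hdiss (k) : ContinuousOn (fun t => znorm k ^ 2 * ‖a t k‖ ^ 2) (Icc t₀ t₁) := by
    have := ha k
    fun_prop
  have hdissSum := hasSum_integral_of_lintegral_tsum_enorm (μ := volume.restrict (Icc t₀ t₁))
    (fun k => (hdiss k).aestronglyMeasurable measurableSet_Icc) (by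
      refine ne_top_of_le_ne_top (b := ∫⁻ _ in Icc t₀ t₁, ENNReal.ofReal M) ?_
        (setLIntegral_mono measurable_const fun t h =>
          (tsum_enorm_dissipation_le (a t)).trans (hmass t h))
      rw [setLIntegral_const]
      exact ENNReal.mul_ne_top ENNReal.ofReal_ne_top (by simp))
  have htransferSum := hasSum_integral_of_lintegral_tsum_enorm
    (μ := volume.restrict (Icc t₀ t₁))
    (fun k => (htransfer k).aestronglyMeasurable measurableSet_Icc) (by
      refine ne_top_of_le_ne_top (b := ∫⁻ t in Icc t₀ t₁,
        (ENNReal.ofReal (4 * π) * (2 * ENNReal.ofReal M)) *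
          ∑' k : Fin d → ℤ, ENNReal.ofReal ((1 + znorm k) * cnorm (v t k))) ?_
        (setLIntegral_mono (hvmeas.const_mul _) fun t h =>
          (tsum_enorm_energyTransfer_le (v t) (a t)).trans ?_)
      · rw [lintegral_const_mul _ hvmeas]
        exact ENNReal.mul_ne_top (by finiteness) hvint
      · rw [mul_assoc (ENNReal.ofReal (4 * π))]
        gcongr
        exact hmass t h)
  have hzero : ∫ t in Icc t₀ t₁, ∑' k, energyTransfer (v t) (a t) k = 0 := by
    refine integral_eq_zero_of_ae ?_
    filter_upwards [ae_lt_top hvmeas hvint, ae_restrict_mem measurableSet_Icc] with t hv h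
    exact tsum_energyTransfer_eq_zero (hdiv t h) (hreal t h) hv.ne (hmass' t h)
  rw [hzero] at htransferSum
  have hbalance (k : Fin d → ℤ) := mode_energy_balance ht.le (hODE k) (htransfer k)
  simp_rw [intervalIntegral.integral_of_le ht.le, ← integral_Icc_eq_integral_Ioc] at hbalance ⊢
  have hleft := (summable_norm_sq_of_sobolevMass (hmass' t₁ (right_mem_Icc.2 ht.le))).hasSum.add
    (hdissSum.mul_left (8 * π ^ 2 * ν))
  have hright := (summable_norm_sq_of_sobolevMass (hmass' t₀ (left_mem_Icc.2 ht.le))).hasSum.add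
    htransferSum
  rw [add_zero] at hright
  simp_rw [hbalance] at hleft
  exact hleft.unique hright
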